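/- arXiv:2304.04626 — 3 statements merged into one kernel-verified Lean document; each statement's English description precedes it below -/
import Mathlib

section
/- (Dekel–Lipman–Rustichini) Suppose the knowledge operator K' satisfies necessitation (K' Ω = Ω), KU introspection at an event E (K' (U' E) = ∅), and AU introspection at E (U' E ⊆ U' (U' E)). Then the unawareness of E is trivial: U' E = ∅. -/
open Set

variable {Ω : Type*}

/-- The unawareness operator induced by a knowledge operator `K'`:
`U' E = ⋂_{n ≥ 1} (¬K')ⁿ E`, where `¬K' A = Ω \ K' A = (K' A)ᶜ`. -/
def unaw (K : Set Ω → Set Ω) (E : Set Ω) : Set Ω :=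
  ⋂ n : ℕ, (fun A => (K A)ᶜ)^[n + 1] E

/-- Dekel–Lipman–Rustichini: If `K'` satisfies necessitation (`K' Ω = Ω`),
KU introspection at `E` (`K' (U' E) = ∅`), and AU introspection at `E`
(`U' E ⊆ U' (U' E)`), then `U' E = ∅`. -/
theorem stmt_7 (K' : Set Ω → Set Ω) (E : Set Ω)
    (hnec : K' univ = univ)
    (hKU : K' (unaw K' E) = ∅)
    (hAU : unaw K' E ⊆ unaw K' (unaw K' E)) :
    unaw K' E = ∅ := by
  refine eq_empty_of_forall_notMem fun x hx => ?_
  have h := mem_iInter.1 (hAU hx) 1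
  change x ∈ (K' (K' (unaw K' E))ᶜ)ᶜ at h
  rw [hKU, compl_empty, hnec] at h
  exact h (mem_univ x)
end

section
/- Suppose the knowledge operator K' satisfies KU introspection at an event E (K' (U' E) = ∅), AU introspection at E (U' E ⊆ U' (U' E)), and R necessitation (K' Ω = Ω \ U' Ω). Then U' E ⊆ U' Ω. -/
open Set

variable {Ω : Type*}

/-- If `K'` satisfies KU introspection at `E` (`K' (U' E) = ∅`),
AU introspection at `E` (`U' E ⊆ U' (U' E)`), and R necessitation
(`K' Ω = Ω \ U' Ω`), then `U' E ⊆ U' Ω`. -/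
theorem stmt_9 (K' : Set Ω → Set Ω) (E : Set Ω)
    (hKU : K' (unaw K' E) = ∅)
    (hAU : unaw K' E ⊆ unaw K' (unaw K' E))
    (hRnec : K' univ = univ \ unaw K' univ) :
    unaw K' E ⊆ unaw K' univ := by
  intro x hx
  have h := mem_iInter.mp (hAU hx) 1
  have h2 : x ∈ (K' (K' (unaw K' E))ᶜ)ᶜ := h
  rw [hKU, compl_empty, hRnec] at h2
  by_contra hc
  exact h2 ⟨mem_univ x, hc⟩
end

section
/- Suppose the knowledge operator K' satisfies KU introspection and AU introspection at every event E ⊆ Ω, and satisfies R necessitation (K' Ω = Ω \ U' Ω). Then the unawareness of the full state-space equals the union of the unawareness of all events: U' Ω = ⋃_{E ⊆ Ω} U' E. -/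
open Set

variable {Ω : Type*}

/-- If `K'` satisfies KU introspection and AU introspection at every event,
and R necessitation (`K' Ω = Ω \ U' Ω`), then the unawareness of the full state-space
equals the union of the unawareness of all events: `U' Ω = ⋃_{E ⊆ Ω} U' E`. -/
theorem stmt_10 (K' : Set Ω → Set Ω)
    (hKU : ∀ E : Set Ω, K' (unaw K' E) = ∅)
    (hAU : ∀ E : Set Ω, unaw K' E ⊆ unaw K' (unaw K' E))
    (hRnec : K' univ = univ \ unaw K' univ) :
    unaw K' univ = ⋃ E : Set Ω, unaw K' E := by
  apply Subset.antisymm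
  · exact subset_iUnion (fun E => unaw K' E) univ
  · refine iUnion_subset fun E x hx => ?_
    have h := hAU E hx
    simp only [unaw, mem_iInter] at h ⊢
    intro n
    have h2 := h (n + 1)
    rw [Function.iterate_succ_apply] at h2
    have h3 : (K' (⋂ n : ℕ, (fun A => (K' A)ᶜ)^[n + 1] E))ᶜ = univ := by
      have := hKU E
      unfold unaw at this
      rw [this, compl_empty]
    simp only [h3] at h2
    exact h2
end
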